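/- Fix an arbitrary instruction field, a configuration η : ℤ^d → ℕ_ρ, and a finite set V ⊆ ℤ^d. If α and β are legal toppling sequences for η, both contained in V and both stabilizing η in V, then m_α = m_β; in particular Φ_α η = Φ_β η. (Global abelianness of the Diaconis–Fulton representation.) -/

import Mathlib

/-!
Site-wise (Diaconis–Fulton) representation of Activated Random Walks on ℤ^d,
and the local abelianness property.
-/

namespace ARW

/-- Sites of the lattice `ℤ^d`. -/
abbrev Site (d : ℕ) := Fin d → ℤ

/-- The set `ℕ_ρ = {0, ρ, 1, 2, 3, …}`: `rho` stands for one passive (sleeping)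
particle, `of n` stands for `n` active particles. -/
inductive NatRho where
  | rho : NatRho
  | of (n : ℕ) : NatRho
deriving DecidableEq

/-- A configuration of the ARW. -/
abbrev Config (d : ℕ) := Site d → NatRho

/-- An instruction: `some y` means "jump by `y`", `none` means "try to sleep" (ρ). -/
abbrev Instr (d : ℕ) := Option (Site d)

/-- An instruction field `I = (I^{x,j})`, the `j`-th instruction at site `x`
(instructions are indexed from `0`). -/
abbrev Field (d : ℕ) := Site d → ℕ → Instr d

/-- Effect, at the target site, of an arriving particle: a passive particle is
activated (ρ becomes 2), otherwise the number of active particles increases by one. -/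
def addP : NatRho → NatRho
  | .rho => .of 2
  | .of n => .of (n + 1)

/-- Effect, at the source site, of a departing active particle. -/
def remP : NatRho → NatRho
  | .rho => .rho
  | .of n => .of (n - 1)

/-- Effect of a sleep instruction ρ: a single active particle falls asleep;
otherwise nothing changes. -/
def sleepy : NatRho → NatRho
  | .of 1 => .rho
  | s => s

/-- A site is unstable when it carries at least one active particle. -/
def IsUnstable {d : ℕ} (η : Config d) (x : Site d) : Prop :=
  ∃ n : ℕ, η x = .of (n + 1)

/-- A state: configuration together with the counter `h` of used instructions. -/
abbrev State (d : ℕ) := Config d × (Site d → ℕ)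

/-- Toppling of the site `x`: consume the next unused instruction at `x` and
perform it, incrementing the counter at `x`. -/
def topple {d : ℕ} (I : Field d) (x : Site d) (s : State d) : State d :=
  let η := s.1
  let h := s.2
  let h' := Function.update h x (h x + 1)
  match I x (h x) with
  | none => (Function.update η x (sleepy (η x)), h')
  | some y =>
      let η₁ := Function.update η x (remP (η x))
      (Function.update η₁ (x + y) (addP (η₁ (x + y))), h')

/-- Performing a finite sequence of topplings in order. -/
def toppleSeq {d : ℕ} (I : Field d) (α : List (Site d)) (s : State d) : State d :=
  α.foldl (fun s x => topple I x s) s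

/-- A sequence of topplings is legal when each successive toppled site is
unstable at the moment it is toppled. -/
def IsLegal {d : ℕ} (I : Field d) : List (Site d) → State d → Prop
  | [], _ => True
  | x :: rest, s => IsUnstable s.1 x ∧ IsLegal I rest (topple I x s)

/-- `Phi I α η` is the configuration `Φ_α η` obtained from `η` by toppling the
sites of `α` in order, starting with the counter `h ≡ 0`. -/
def Phi {d : ℕ} (I : Field d) (α : List (Site d)) (η : Config d) : Config d :=
  (toppleSeq I α (η, fun _ => 0)).1

end ARW

open ARW


namespace ARW

/-- A configuration is stable in `V` when every site of `V` is stable. -/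
def StableIn {d : ℕ} (η : Config d) (V : Finset (Site d)) : Prop :=
  ∀ x ∈ V, ¬ IsUnstable η x

end ARW

namespace ARW

/-- Effect on the content of the site `z` of performing the instruction `τ` at the site `x`. -/
def effect {d : ℕ} (τ : Instr d) (x z : Site d) (k : NatRho) : NatRho :=
  match τ with
  | none => if z = x then sleepy k else k
  | some y =>
      if z = x + y then addP (if z = x then remP k else k)
      else if z = x then remP k else k

lemma topple_fst_apply {d : ℕ} (I : Field d) (x z : Site d) (s : State d) :
    (topple I x s).1 z = effect (I x (s.2 x)) x z (s.1 z) := by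
  cases hI : I x (s.2 x) with
  | none =>
    simp only [topple, effect, hI, Function.update_apply]
    grind
  | some y =>
    simp only [topple, effect, hI, Function.update_apply]
    grind

lemma topple_snd {d : ℕ} (I : Field d) (x : Site d) (s : State d) :
    (topple I x s).2 = Function.update s.2 x (s.2 x + 1) := by
  cases hI : I x (s.2 x) <;> simp only [topple, hI]

lemma effect_of_ne {d : ℕ} (τ : Instr d) {x z : Site d} (hz : z ≠ x) :
    effect τ x z = id ∨ effect τ x z = addP := by
  cases τ with
  | none => left; funext k; simp [effect, hz]
  | some y =>
    by_cases hy : z = x + y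
    · right; funext k; simp only [effect, if_pos hy, if_neg hz]
    · left; funext k; simp [effect, hz, hy]

lemma effect_addP {d : ℕ} (τ : Instr d) (x z : Site d) {k : NatRho}
    (hk : z = x → ∃ n : ℕ, k = .of (n + 1)) :
    effect τ x z (addP k) = addP (effect τ x z k) := by
  by_cases hz : z = x
  · obtain ⟨n, rfl⟩ := hk hz
    cases τ with
    | none => cases n <;> simp [effect, hz, addP, sleepy]
    | some y => by_cases hy : y = 0 <;> simp [effect, hz, hy, addP, remP]
  · rcases effect_of_ne τ hz with h | h <;> rw [h]
    rfl

lemma effect_comm {d : ℕ} (τ σ : Instr d) {x y : Site d} (hxy : x ≠ y) (z : Site d) {k : NatRho}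
    (hx : z = x → ∃ n : ℕ, k = .of (n + 1)) (hy : z = y → ∃ n : ℕ, k = .of (n + 1)) :
    effect τ x z (effect σ y z k) = effect σ y z (effect τ x z k) := by
  by_cases hz : z = x
  · rcases effect_of_ne σ (fun h : z = y => hxy (hz.symm.trans h)) with h | h <;> rw [h]
    · rfl
    · exact effect_addP τ x z hx
  · rcases effect_of_ne τ hz with h | h <;> rw [h]
    · rfl
    · exact (effect_addP σ y z hy).symm

lemma topple_comm {d : ℕ} (I : Field d) {x y : Site d} (hxy : x ≠ y) {s : State d}
    (hx : IsUnstable s.1 x) (hy : IsUnstable s.1 y) :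
    topple I x (topple I y s) = topple I y (topple I x s) := by
  refine Prod.ext (funext fun z => ?_) ?_
  · simp only [topple_fst_apply, topple_snd, Function.update_of_ne hxy,
      Function.update_of_ne hxy.symm]
    exact effect_comm _ _ hxy z (fun h => h ▸ hx) (fun h => h ▸ hy)
  · simp only [topple_snd, Function.update_of_ne hxy, Function.update_of_ne hxy.symm]
    exact Function.update_comm hxy.symm _ _ _

lemma IsUnstable.topple_of_ne {d : ℕ} (I : Field d) {x y : Site d} (hxy : x ≠ y) {s : State d}
    (hx : IsUnstable s.1 x) : IsUnstable (topple I y s).1 x := by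
  obtain ⟨n, hn⟩ := hx
  unfold IsUnstable
  rw [topple_fst_apply, hn]
  rcases effect_of_ne (I y (s.2 y)) hxy with h | h <;> rw [h]
  · exact ⟨n, rfl⟩
  · exact ⟨n + 1, rfl⟩

/-- In a legal sequence after which `x` is stable, the first toppling of an initially unstable
site `x` can be moved to the front. -/
lemma IsLegal.move_to_front {d : ℕ} (I : Field d) {x : Site d} {β : List (Site d)} {s : State d}
    (hβ : IsLegal I β s) (hx : IsUnstable s.1 x) (hxs : ¬ IsUnstable (toppleSeq I β s).1 x) :
    x ∈ β ∧ IsLegal I (β.erase x) (topple I x s) ∧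
      toppleSeq I (β.erase x) (topple I x s) = toppleSeq I β s := by
  induction β generalizing s with
  | nil => exact absurd hx hxs
  | cons y r ih =>
    by_cases hyx : y = x
    · subst hyx
      rw [List.erase_cons_head]
      exact ⟨List.mem_cons_self, hβ.2, rfl⟩
    · have hxy : x ≠ y := Ne.symm hyx
      obtain ⟨hmem, hleg, heq⟩ := ih hβ.2 (hx.topple_of_ne I hxy) hxs
      rw [topple_comm I hxy hx hβ.1] at hleg heq
      rw [List.erase_cons_tail (by simpa using hyx)]
      exact ⟨List.mem_cons_of_mem _ hmem, ⟨hβ.1.topple_of_ne I hyx, hleg⟩, heq⟩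

/-- Two legal sequences in `V` that stabilize the same state in `V` are permutations of each
other and lead to the same state. -/
lemma IsLegal.perm_and_toppleSeq_eq {d : ℕ} (I : Field d) {V : Finset (Site d)}
    {α β : List (Site d)} {s : State d} (hαV : ∀ x ∈ α, x ∈ V) (hβV : ∀ x ∈ β, x ∈ V)
    (hα : IsLegal I α s) (hβ : IsLegal I β s) (hαs : StableIn (toppleSeq I α s).1 V)
    (hβs : StableIn (toppleSeq I β s).1 V) :
    α.Perm β ∧ toppleSeq I α s = toppleSeq I β s := by
  induction α generalizing β s with
  | nil =>
    cases β with
    | nil => exact ⟨.nil, rfl⟩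
    | cons y r => exact absurd hβ.1 (hαs y (hβV y List.mem_cons_self))
  | cons x r ih =>
    obtain ⟨hmem, hleg, heq⟩ :=
      hβ.move_to_front I hα.1 (hβs x (hαV x List.mem_cons_self))
    obtain ⟨hperm, hfin⟩ := ih (fun z hz => hαV z (List.mem_cons_of_mem _ hz))
      (fun z hz => hβV z (List.mem_of_mem_erase hz)) hα.2 hleg hαs (heq ▸ hβs)
    exact ⟨(hperm.cons x).trans (List.perm_cons_erase hmem).symm, hfin.trans heq⟩

end ARW

/-- **Global abelianness.** For a fixed instruction field and finite `V ⊆ ℤ^d`, if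
`α` and `β` are legal toppling sequences for `η`, both contained in `V` and both
stabilizing `η` in `V`, then `m_α = m_β`; in particular `Φ_α η = Φ_β η`. -/
theorem global_abelianness {d : ℕ} (I : Field d) (η : Config d)
    (V : Finset (Site d)) (α β : List (Site d))
    (hαV : ∀ x ∈ α, x ∈ V) (hβV : ∀ x ∈ β, x ∈ V)
    (hα : IsLegal I α (η, fun _ => 0)) (hβ : IsLegal I β (η, fun _ => 0))
    (hαs : StableIn (Phi I α η) V) (hβs : StableIn (Phi I β η) V) :
    (∀ x : Site d, α.count x = β.count x) ∧ Phi I α η = Phi I β η := by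
  obtain ⟨hperm, heq⟩ := IsLegal.perm_and_toppleSeq_eq I hαV hβV hα hβ hαs hβs
  exact ⟨fun x => hperm.count_eq x, congrArg Prod.fst heq⟩
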